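/- arXiv:0911.3173 — 2 statements merged into one kernel-verified Lean document; each statement's English description precedes it below -/
import Mathlib

section
/- Let T₁ and T₂ be universally elliptic 𝒜-trees. Then there exist a universally elliptic 𝒜-tree T̂₁ and a collapse map T̂₁ → T₁ such that T̂₁ dominates T₂, and a subgroup of G is elliptic in T̂₁ if and only if it is elliptic in both T₁ and T₂. -/
universe u v

/-- A `G`-tree: a nonempty simple graph which is a tree (connected and acyclic),
with a minimal action of `G` by graph automorphisms without inversions. -/
structure GTree (G : Type u) [Group G] : Type (u + 1) where
  V : Type u
  graph : SimpleGraph V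
  nonempty : Nonempty V
  connected : graph.Connected
  acyclic : graph.IsAcyclic
  act : G → V → V
  act_one : ∀ w, act 1 w = w
  act_mul : ∀ g h w, act (g * h) w = act g (act h w)
  act_adj : ∀ g a b, graph.Adj a b → graph.Adj (act g a) (act g b)
  noInversion : ∀ g a b, graph.Adj a b → ¬(act g a = b ∧ act g b = a)
  minimal : ∀ S : Set V, S.Nonempty → (∀ g, ∀ w ∈ S, act g w ∈ S) →
    (graph.induce S).Connected → S = Set.univ

namespace GTree

variable {G : Type u} [Group G]

/-- The stabilizer of a vertex. -/
def vertexStab (T : GTree G) (w : T.V) : Subgroup G where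
  carrier := {g | T.act g w = w}
  one_mem' := T.act_one w
  mul_mem' := by
    intro a b ha hb
    simp only [Set.mem_setOf_eq] at *
    rw [T.act_mul, hb, ha]
  inv_mem' := by
    intro a ha
    simp only [Set.mem_setOf_eq] at *
    calc T.act a⁻¹ w = T.act a⁻¹ (T.act a w) := by rw [ha]
    _ = T.act (a⁻¹ * a) w := (T.act_mul _ _ _).symm
    _ = w := by rw [inv_mul_cancel, T.act_one]

/-- The stabilizer of an edge `{u,v}`: elements fixing both endpoints. -/
def edgeStab (T : GTree G) (a b : T.V) : Subgroup G :=
  T.vertexStab a ⊓ T.vertexStab b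

/-- A subgroup is elliptic in `T` if it fixes a vertex. -/
def EllipticSubgroup (T : GTree G) (H : Subgroup G) : Prop :=
  ∃ w : T.V, ∀ h ∈ H, T.act h w = w

/-- An element is elliptic in `T` if it fixes a vertex (otherwise it is hyperbolic). -/
def EllipticElt (T : GTree G) (g : G) : Prop :=
  ∃ w : T.V, T.act g w = w

/-- `T₁` dominates `T₂`: every subgroup elliptic in `T₁` is elliptic in `T₂`. -/
def Dominates (T₁ T₂ : GTree G) : Prop :=
  ∀ H : Subgroup G, T₁.EllipticSubgroup H → T₂.EllipticSubgroup H

/-- `T` is an `𝒜`-tree: all its edge stabilizers belong to `𝒜`. -/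
def IsATree (T : GTree G) (𝒜 : Set (Subgroup G)) : Prop :=
  ∀ a b : T.V, T.graph.Adj a b → T.edgeStab a b ∈ 𝒜

/-- A subgroup is universally elliptic if it is elliptic in every `𝒜`-tree. -/
def UnivEllipticSubgroup (𝒜 : Set (Subgroup G)) (H : Subgroup G) : Prop :=
  ∀ T : GTree G, T.IsATree 𝒜 → T.EllipticSubgroup H

/-- An `𝒜`-tree is universally elliptic if all its edge stabilizers are universally elliptic. -/
def UnivEllipticTree (T : GTree G) (𝒜 : Set (Subgroup G)) : Prop :=
  ∀ a b : T.V, T.graph.Adj a b → UnivEllipticSubgroup 𝒜 (T.edgeStab a b)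

/-- A JSJ tree of `G` over `𝒜`: a universally elliptic `𝒜`-tree dominating every
universally elliptic `𝒜`-tree. -/
def IsJSJ (T : GTree G) (𝒜 : Set (Subgroup G)) : Prop :=
  T.IsATree 𝒜 ∧ T.UnivEllipticTree 𝒜 ∧
    ∀ T' : GTree G, T'.IsATree 𝒜 → T'.UnivEllipticTree 𝒜 → T.Dominates T'

/-- A collapse map `T → T'`: a `G`-equivariant surjection on vertices sending adjacent
vertices to adjacent or equal vertices, with connected point preimages. -/
def IsCollapseMap (T T' : GTree G) (f : T.V → T'.V) : Prop :=
  (∀ g w, f (T.act g w) = T'.act g (f w)) ∧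
    Function.Surjective f ∧
    (∀ a b : T.V, T.graph.Adj a b → f a = f b ∨ T'.graph.Adj (f a) (f b)) ∧
    ∀ w : T'.V, (T.graph.induce (f ⁻¹' {w})).Connected

end GTree

/-- `𝒜` is closed under conjugation and under passing to subgroups. -/
def ClosedFamily {G : Type u} [Group G] (𝒜 : Set (Subgroup G)) : Prop :=
  (∀ H ∈ 𝒜, ∀ g : G, Subgroup.map (MulAut.conj g).toMonoidHom H ∈ 𝒜) ∧
    ∀ H ∈ 𝒜, ∀ K : Subgroup G, K ≤ H → K ∈ 𝒜

/-- `G` is finitely presented: it admits a presentation with finitely many generators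
and finitely many relations. -/
def FinitelyPresentedGroup (G : Type u) [Group G] : Prop :=
  ∃ (n : ℕ) (rels : Set (FreeGroup (Fin n))),
    rels.Finite ∧ Nonempty (PresentedGroup rels ≃* G)

/-- `T` is an `(𝒜,ℋ)`-tree: an `𝒜`-tree in which every subgroup in `ℋ` is elliptic. -/
def RelATree {G : Type u} [Group G] (𝒜 ℋ : Set (Subgroup G)) (T : GTree G) : Prop :=
  T.IsATree 𝒜 ∧ ∀ H ∈ ℋ, T.EllipticSubgroup H

/-- A subgroup is universally elliptic relative to `ℋ` if it is elliptic in every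
`(𝒜,ℋ)`-tree. -/
def RelUnivEllipticSubgroup {G : Type u} [Group G] (𝒜 ℋ : Set (Subgroup G))
    (K : Subgroup G) : Prop :=
  ∀ T : GTree G, RelATree 𝒜 ℋ T → T.EllipticSubgroup K

/-- An `(𝒜,ℋ)`-tree is universally elliptic if all its edge stabilizers are universally
elliptic relative to `ℋ`. -/
def RelUnivEllipticTree {G : Type u} [Group G] (𝒜 ℋ : Set (Subgroup G))
    (T : GTree G) : Prop :=
  ∀ a b : T.V, T.graph.Adj a b → RelUnivEllipticSubgroup 𝒜 ℋ (T.edgeStab a b)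

/-- A JSJ tree of `G` over `𝒜` relative to `ℋ`. -/
def IsRelJSJ {G : Type u} [Group G] (𝒜 ℋ : Set (Subgroup G)) (T : GTree G) : Prop :=
  RelATree 𝒜 ℋ T ∧ RelUnivEllipticTree 𝒜 ℋ T ∧
    ∀ T' : GTree G, RelATree 𝒜 ℋ T' → RelUnivEllipticTree 𝒜 ℋ T' → T.Dominates T'

/-- The family of groups `F, H₁, …, H_p` whose free product is used to define relative
finite presentability. -/
def relFam {G : Type u} [Group G] {p : ℕ} (H : Fin p → Subgroup G) (n : ℕ) :
    Option (Fin p) → Type u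
  | none => FreeGroup (ULift.{u} (Fin n))
  | some j => H j

instance relFamGroup {G : Type u} [Group G] {p : ℕ} (H : Fin p → Subgroup G) (n : ℕ) :
    (i : Option (Fin p)) → Group (relFam H n i)
  | none => inferInstanceAs (Group (FreeGroup _))
  | some j => inferInstanceAs (Group (H j))

/-- `G` is finitely presented relative to `H₁, …, H_p`: there is a surjection from
`F ∗ H₁ ∗ ⋯ ∗ H_p` (with `F` a finitely generated free group) onto `G` restricting to
the inclusion on each `Hᵢ`, whose kernel is the normal closure of a finite subset. -/
def RelFinitelyPresented {G : Type u} [Group G] {p : ℕ} (H : Fin p → Subgroup G) : Prop :=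
  ∃ (n : ℕ) (φ : Monoid.CoprodI (relFam H n) →* G),
    Function.Surjective φ ∧
    (∀ (j : Fin p) (h : H j), φ (Monoid.CoprodI.of (M := relFam H n) (i := some j) h) = (h : G)) ∧
    ∃ s : Set (Monoid.CoprodI (relFam H n)), s.Finite ∧
      MonoidHom.ker φ = Subgroup.normalClosure s

/-- `S` has a single orbit of edges. -/
def OneEdgeOrbit {G : Type u} [Group G] (S : GTree G) : Prop :=
  ∀ e₁ ∈ S.graph.edgeSet, ∀ e₂ ∈ S.graph.edgeSet, ∃ g : G, Sym2.map (S.act g) e₁ = e₂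

/-- `G` splits over `K`: there is a nontrivial `G`-tree with a single orbit of edges
having `K` as an edge stabilizer. -/
def SplitsOver {G : Type u} [Group G] (K : Subgroup G) : Prop :=
  ∃ S : GTree G, Nontrivial S.V ∧ OneEdgeOrbit S ∧
    ∃ x y : S.V, S.graph.Adj x y ∧ S.edgeStab x y = K

/-- A subgroup is slender if all its subgroups are finitely generated. -/
def SlenderSubgroup {G : Type u} [Group G] (H : Subgroup G) : Prop :=
  ∀ K : Subgroup G, K ≤ H → K.FG

/-- A subgroup is abelian. -/
def AbelianSubgroup {G : Type u} [Group G] (H : Subgroup G) : Prop :=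
  ∀ a ∈ H, ∀ b ∈ H, a * b = b * a

/-- `H` is malnormal in `G`: `gHg⁻¹ ∩ H ≠ {1}` implies `g ∈ H`. -/
def Malnormal {G : Type u} [Group G] (H : Subgroup G) : Prop :=
  ∀ g : G, (∃ x ∈ H, x ≠ 1 ∧ g * x * g⁻¹ ∈ H) → g ∈ H

/-- `G` is CSA: the centralizer of every nontrivial element is abelian and malnormal. -/
def IsCSA (G : Type u) [Group G] : Prop :=
  ∀ g : G, g ≠ 1 →
    AbelianSubgroup (Subgroup.centralizer {g}) ∧ Malnormal (Subgroup.centralizer {g})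

namespace SimpleGraph

section Trees

variable {V W : Type*} {X : SimpleGraph V} {Y : SimpleGraph W}

theorem Reachable.of_adj_reachable (f : V → W)
    (hf : ∀ a b, X.Adj a b → Y.Reachable (f a) (f b)) {a b : V} (h : X.Reachable a b) :
    Y.Reachable (f a) (f b) := by
  obtain ⟨p⟩ := h
  induction p with
  | nil => exact Reachable.refl _
  | cons hadj _ ih => exact (hf _ _ hadj).trans ih

theorem Connected.of_surjective_of_adj_reachable (f : V → W) (hsurj : Function.Surjective f)
    (hf : ∀ a b, X.Adj a b → Y.Reachable (f a) (f b)) (h : X.Connected) : Y.Connected := by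
  have : Nonempty W := h.nonempty.map f
  refine ⟨fun a b => ?_⟩
  obtain ⟨a, rfl⟩ := hsurj a
  obtain ⟨b, rfl⟩ := hsurj b
  exact (h.preconnected a b).of_adj_reachable f hf

theorem induce_induce_connected_iff (X : SimpleGraph V) (S : Set V) (U : Set S) :
    ((X.induce S).induce U).Connected ↔ (X.induce (Subtype.val '' U)).Connected := by
  constructor
  · refine Connected.of_surjective_of_adj_reachable
      (fun a => ⟨a.1.1, a.1, a.2, rfl⟩) ?_ fun a b h => Adj.reachable h
    rintro ⟨_, a, ha, rfl⟩
    exact ⟨⟨a, ha⟩, rfl⟩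
  · have key : ∀ a : (Subtype.val '' U : Set V), ∃ hS : a.1 ∈ S, (⟨a.1, hS⟩ : S) ∈ U := by
      rintro ⟨_, a, ha, rfl⟩
      exact ⟨a.2, ha⟩
    refine Connected.of_surjective_of_adj_reachable
      (fun a => ⟨⟨a.1, (key a).1⟩, (key a).2⟩) ?_ fun a b h => Adj.reachable h
    rintro ⟨a, ha⟩
    exact ⟨⟨a.1, a, ha, rfl⟩, rfl⟩

theorem IsAcyclic.support_subset_of_isPath (hX : X.IsAcyclic) {S : Set V} {a b : V}
    (p : X.Walk a b) (hp : p.IsPath) (ha : a ∈ S) (hb : b ∈ S)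
    (hS : (X.induce S).Connected) : ∀ x ∈ p.support, x ∈ S := by
  classical
  obtain ⟨q⟩ := hS.preconnected ⟨a, ha⟩ ⟨b, hb⟩
  have hq : ∀ x ∈ (q.map (Embedding.induce S).toHom).support, x ∈ S := by
    intro x hx
    rw [Walk.support_map, List.mem_map] at hx
    obtain ⟨y, -, rfl⟩ := hx
    exact y.2
  have heq : p = (q.map (Embedding.induce S).toHom).bypass :=
    congrArg Subtype.val ((hX.subsingleton_path a b).elim ⟨p, hp⟩ ⟨_, Walk.bypass_isPath _⟩)
  intro x hx
  rw [heq] at hx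
  exact hq x (Walk.support_bypass_subset_support _ hx)

theorem IsTree.induce_inter_connected (hX : X.IsTree) {S T : Set V}
    (hS : (X.induce S).Connected) (hT : (X.induce T).Connected) (hne : (S ∩ T).Nonempty) :
    (X.induce (S ∩ T)).Connected := by
  have := hne.to_subtype
  refine ⟨?_⟩
  rintro ⟨a, ha⟩ ⟨b, hb⟩
  obtain ⟨p, hp⟩ := hX.connected.exists_isPath a b
  have hsupp : ∀ x ∈ p.support, x ∈ S ∩ T := fun x hx =>
    ⟨hX.isAcyclic.support_subset_of_isPath p hp ha.1 hb.1 hS x hx,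
      hX.isAcyclic.support_subset_of_isPath p hp ha.2 hb.2 hT x hx⟩
  exact ⟨p.induce _ hsupp⟩

/-- In a tree, two points of a subtree realizing the distance to `x` coincide. -/
theorem IsTree.eq_of_dist_minimal (hX : X.IsTree) {S : Set V} (hS : (X.induce S).Connected)
    {x s t : V} (hs : s ∈ S) (ht : t ∈ S) (hmin : ∀ y ∈ S, X.dist x s ≤ X.dist x y)
    (hdist : X.dist x t = X.dist x s) : s = t := by
  classical
  have key : ∀ r, X.dist x r = X.dist x s → ∃ p : X.Walk x r, ∀ y ∈ p.support, y ∈ S → y = r := by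
    intro r hr
    obtain ⟨p, hp⟩ := hX.connected.exists_walk_length_eq_dist x r
    refine ⟨p, fun y hy hyS => ?_⟩
    by_contra hne
    have h₁ := p.length_takeUntil_lt_length hy hne
    have h₂ := dist_le (p.takeUntil y hy)
    have h₃ := hmin y hyS
    omega
  obtain ⟨p, hp⟩ := key s rfl
  obtain ⟨q, hq⟩ := key t hdist
  by_contra hne
  let r := (p.reverse.append q).bypass
  have hr : ∀ y ∈ r.support, y = s ∨ y = t := by
    intro y hy
    have hyS := hX.isAcyclic.support_subset_of_isPath r (Walk.bypass_isPath _) hs ht hS y hy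
    have hy' := Walk.support_bypass_subset_support _ hy
    rw [Walk.mem_support_append_iff, Walk.support_reverse, List.mem_reverse] at hy'
    exact hy'.imp (fun h => hp y h hyS) (fun h => hq y h hyS)
  have hnil : ¬ r.Nil := Walk.not_nil_of_ne hne
  have hadj := r.adj_snd hnil
  rcases hr _ (r.getVert_mem_support 1) with h | h
  · exact hadj.ne h.symm
  · have hst : X.Adj s t := by
      have h' : r.snd = t := h
      rwa [h'] at hadj
    exact hX.dist_ne_of_adj x hst hdist.symm

/-- For every vertex `v` of an acyclic connected graph, there is a map sending a vertex `w ≠ v`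
to the neighbour of `v` separating `v` from `w`. -/
theorem IsTree.exists_branch (hX : X.IsTree) (v : V) :
    ∃ r : V → V, (∀ w, X.Adj v w → r w = w) ∧
      ∀ w w', w ≠ v → w' ≠ v → X.Adj w w' → r w = r w' := by
  choose p hp using fun w => hX.connected.exists_isPath v w
  have hconcat : ∀ {a b : V} (q : X.Walk v a) (h : X.Adj a b), a ≠ v →
      (q.concat h).snd = q.snd := by
    intro a b q h hne
    cases q with
    | nil => exact absurd rfl hne
    | cons h' q => simp [Walk.concat_cons]
  refine ⟨fun w => (p w).snd, fun w hw => ?_, fun w w' hw hw' hadj => ?_⟩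
  · exact (hX.isAcyclic.eq_snd_of_adj_start (hp w) hw (Walk.end_mem_support _)).symm
  · by_cases h : w ∈ (p w').support
    · dsimp only
      rw [hX.isAcyclic.path_concat (hp w) (hp w') hadj h, hconcat _ _ hw]
    · have h' := hX.isAcyclic.mem_support_of_ne_mem_support_of_adj_of_isPath (hp w) (hp w') hadj h
      dsimp only
      rw [hX.isAcyclic.path_concat (hp w') (hp w) hadj.symm h', hconcat _ _ hw']

/-- The graph obtained from `X` by replacing every vertex with a copy of `Y` and attaching each
edge `e` of `X` to the two corresponding copies at the vertex `p e`. -/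
def blowup (X : SimpleGraph V) (Y : SimpleGraph W) (p : Sym2 V → W) : SimpleGraph (V × W) where
  Adj a b := (a.1 = b.1 ∧ Y.Adj a.2 b.2) ∨
    (X.Adj a.1 b.1 ∧ a.2 = p s(a.1, b.1) ∧ b.2 = p s(a.1, b.1))
  symm := ⟨by
    rintro a b (⟨h, h'⟩ | ⟨h, h', h''⟩)
    · exact Or.inl ⟨h.symm, h'.symm⟩
    · exact Or.inr ⟨h.symm, by rw [Sym2.eq_swap, h''], by rw [Sym2.eq_swap, h']⟩⟩
  loopless := ⟨by
    rintro a (⟨-, h⟩ | ⟨h, -⟩)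
    · exact h.ne rfl
    · exact h.ne rfl⟩

variable {p : Sym2 V → W}

theorem blowup_reachable_fiber (hY : Y.Connected) (v : V) (y z : W) :
    (X.blowup Y p).Reachable (v, y) (v, z) :=
  (hY.preconnected y z).of_adj_reachable (fun y => (v, y))
    fun _ _ h => Adj.reachable (Or.inl ⟨rfl, h⟩)

theorem blowup_connected (hX : X.Connected) (hY : Y.Connected) : (X.blowup Y p).Connected := by
  have := hX.nonempty
  have := hY.nonempty
  refine ⟨?_⟩
  rintro ⟨v, y⟩ ⟨w, z⟩
  refine Reachable.trans ?_ (blowup_reachable_fiber hY w y z)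
  refine (hX.preconnected v w).of_adj_reachable (fun v => (v, y)) fun a b h => ?_
  refine (blowup_reachable_fiber hY a y (p s(a, b))).trans
    (Reachable.trans ?_ (blowup_reachable_fiber hY b (p s(a, b)) y))
  exact Adj.reachable (Or.inr ⟨h, rfl, rfl⟩)

theorem blowup_induce_fiber_connected (hY : Y.Connected) (v : V) :
    ((X.blowup Y p).induce {a | a.1 = v}).Connected := by
  refine hY.of_surjective_of_adj_reachable (fun y => ⟨(v, y), rfl⟩) ?_
    fun a b h => Adj.reachable (Or.inl ⟨rfl, h⟩)
  rintro ⟨⟨w, y⟩, rfl⟩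
  exact ⟨y, rfl⟩

theorem blowup_isAcyclic (hX : X.IsTree) (hY : Y.IsTree) : (X.blowup Y p).IsAcyclic := by
  rw [isAcyclic_iff_forall_adj_isBridge]
  rintro ⟨v, y⟩ ⟨w, z⟩ (⟨h, h'⟩ | ⟨h, h', h''⟩)
  · obtain rfl : v = w := h
    obtain ⟨r, hr, hr'⟩ := hX.exists_branch v
    have hb := isAcyclic_iff_forall_adj_isBridge.1 hY.isAcyclic h'
    rw [isBridge_iff] at hb ⊢
    refine fun hreach => hb ?_
    classical
    have := hreach.of_adj_reachable (Y := Y.deleteEdges {s(y, z)})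
      (fun a => if a.1 = v then a.2 else p s(v, r a.1)) ?_
    · simpa using this
    rintro ⟨a, c⟩ ⟨b, d⟩ hadj
    rw [deleteEdges_adj] at hadj
    obtain ⟨⟨hab, hcd⟩ | ⟨hab, hc, hd⟩, hnot⟩ := hadj
    · obtain rfl : a = b := hab
      by_cases hav : a = v
      · subst hav
        simp only [if_true]
        refine Adj.reachable ?_
        rw [deleteEdges_adj]
        exact ⟨hcd, fun hmem => hnot (by simpa using hmem)⟩
      · simp [hav]
    · dsimp only at hab hc hd ⊢
      by_cases hav : a = v
      · subst hav
        rw [if_pos rfl, if_neg hab.ne', hr b hab, hc]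
      · by_cases hbv : b = v
        · subst hbv
          rw [if_neg hav, if_pos rfl, hr a hab.symm, hd, @Sym2.eq_swap _ b a]
        · rw [if_neg hav, if_neg hbv, hr' a b hav hbv hab]
  · have hb := isAcyclic_iff_forall_adj_isBridge.1 hX.isAcyclic h
    rw [isBridge_iff] at hb ⊢
    refine fun hreach => hb ?_
    refine hreach.of_adj_reachable (Y := X.deleteEdges {s(v, w)}) Prod.fst ?_
    rintro ⟨a, c⟩ ⟨b, d⟩ hadj
    rw [deleteEdges_adj] at hadj
    obtain ⟨⟨hab, hcd⟩ | ⟨hab, hc, hd⟩, hnot⟩ := hadj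
    · obtain rfl : a = b := hab
      exact Reachable.refl _
    · refine Adj.reachable ?_
      rw [deleteEdges_adj]
      refine ⟨hab, fun hmem => hnot ?_⟩
      have hmem' : s(a, b) = s(v, w) := hmem
      dsimp only at h' h'' hc hd hab
      rw [hmem', ← h'] at hc
      rw [hmem', ← h'] at hd
      have hzy : z = y := h''.trans h'.symm
      subst hc hzy
      subst hd
      simpa using hmem'

theorem blowup_isTree (hX : X.IsTree) (hY : Y.IsTree) : (X.blowup Y p).IsTree :=
  ⟨blowup_connected hX.connected hY.connected, blowup_isAcyclic hX hY⟩

end Trees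

section Action

variable {G V : Type*} [Group G] [MulAction G V] {X : SimpleGraph V}

theorem dist_smul (hadj : ∀ (g : G) a b, X.Adj a b → X.Adj (g • a) (g • b)) (hX : X.Connected)
    (g : G) (a b : V) : X.dist (g • a) (g • b) = X.dist a b := by
  have key : ∀ (g : G) a b, X.dist (g • a) (g • b) ≤ X.dist a b := by
    intro g a b
    obtain ⟨q, hq⟩ := hX.exists_walk_length_eq_dist a b
    let f : X →g X := ⟨(g • ·), fun h => hadj g _ _ h⟩
    rw [← hq, ← Walk.length_map f q]
    exact dist_le _
  refine le_antisymm (key g a b) ?_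
  simpa using key g⁻¹ (g • a) (g • b)

/-- A subgroup fixing a vertex of a tree fixes a vertex in every invariant subtree. -/
theorem IsTree.exists_fixed_of_invariant
    (hadj : ∀ (g : G) a b, X.Adj a b → X.Adj (g • a) (g • b)) (hX : X.IsTree)
    {S : Set V} (hinv : ∀ (g : G), ∀ w ∈ S, g • w ∈ S) (hS : (X.induce S).Connected)
    {H : Subgroup G} {x : V} (hx : ∀ h ∈ H, h • x = x) : ∃ s ∈ S, ∀ h ∈ H, h • s = s := by
  have := hS.nonempty
  obtain ⟨⟨s, hs⟩, hmin⟩ : ∃ s : S, ∀ t : S, X.dist x s ≤ X.dist x t := by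
    refine ⟨Function.argmin (fun t : S => X.dist x t), fun t => ?_⟩
    exact Function.argmin_le (fun t : S => X.dist x t) t
  refine ⟨s, hs, fun h hh => (hX.eq_of_dist_minimal (x := x) hS hs (hinv h s hs)
    (fun y hy => hmin ⟨y, hy⟩) ?_).symm⟩
  conv_lhs => rw [← hx h hh]
  exact dist_smul hadj hX.connected h x s

/-- A finitely generated group acting on a connected graph preserves a nonempty connected
vertex set meeting finitely many orbits. -/
theorem Connected.exists_invariant_finite_orbits
    (hadj : ∀ (g : G) a b, X.Adj a b → X.Adj (g • a) (g • b)) (hX : X.Connected)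
    (hfg : Group.FG G) :
    ∃ S : Set V, (∀ (g : G), ∀ w ∈ S, g • w ∈ S) ∧ (X.induce S).Connected ∧
      (Quotient.mk (MulAction.orbitRel G V) '' S).Finite := by
  obtain ⟨F, hF⟩ := Group.fg_def.1 hfg
  obtain ⟨x⟩ := hX.nonempty
  let p : ∀ g : G, X.Walk x (g • x) := fun g => (hX.preconnected x (g • x)).some
  let K : Set V := {x} ∪ ⋃ g ∈ F, {u | u ∈ (p g).support}
  let S : Set V := {w | ∃ g : G, ∃ u ∈ K, w = g • u}
  have hinv : ∀ (g : G), ∀ w ∈ S, g • w ∈ S := by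
    rintro g _ ⟨k, u, hu, rfl⟩
    exact ⟨g * k, u, hu, (mul_smul _ _ _).symm⟩
  have hKS : ∀ u ∈ K, u ∈ S := fun u hu => ⟨1, u, hu, (one_smul _ _).symm⟩
  have hxS : x ∈ S := hKS x (Or.inl rfl)
  have htrans : ∀ (g : G) (a b : S), (X.induce S).Reachable a b →
      (X.induce S).Reachable ⟨g • a.1, hinv g _ a.2⟩ ⟨g • b.1, hinv g _ b.2⟩ :=
    fun g a b h => h.of_adj_reachable (fun a : S => (⟨g • a.1, hinv g _ a.2⟩ : S))
      fun a b h => Adj.reachable (hadj g _ _ h)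
  have hgen : ∀ g ∈ F, ∀ x' ∈ (p g).support, x' ∈ S := fun g hg x' hx' =>
    hKS x' (Or.inr (Set.mem_biUnion hg hx'))
  have hreach : ∀ g : G, (X.induce S).Reachable ⟨x, hxS⟩ ⟨g • x, hinv g x hxS⟩ := by
    intro g
    have hg : g ∈ Subgroup.closure (F : Set G) := by rw [hF]; trivial
    induction hg using Subgroup.closure_induction with
    | mem g hg => exact ⟨(p g).induce S (hgen g hg)⟩
    | one => simp
    | mul g k _ _ hg hk => simpa only [mul_smul] using hg.trans (htrans g _ _ hk)
    | inv g _ hg => simpa using (htrans g⁻¹ _ _ hg).symm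
  refine ⟨S, hinv, ?_, ?_⟩
  · have hroot : ∀ a : S, (X.induce S).Reachable ⟨x, hxS⟩ a := by
      classical
      rintro ⟨_, g, u, hu, rfl⟩
      refine (hreach g).trans (htrans g ⟨x, hxS⟩ ⟨u, hKS u hu⟩ ?_)
      rcases hu with rfl | hu
      · exact Reachable.refl _
      · obtain ⟨k, hk, hu⟩ := Set.mem_iUnion₂.1 hu
        exact ⟨((p k).takeUntil u hu).induce S fun y hy =>
          hgen k hk y (Walk.support_takeUntil_subset_support _ _ hy)⟩
    have : Nonempty S := ⟨⟨x, hxS⟩⟩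
    exact ⟨fun a b => (hroot a).symm.trans (hroot b)⟩
  · have hK : K.Finite := (Set.finite_singleton x).union
      (F.finite_toSet.biUnion fun g _ => List.finite_toSet _)
    refine (hK.image (Quotient.mk (MulAction.orbitRel G V))).subset ?_
    rintro _ ⟨_, ⟨g, u, hu, rfl⟩, rfl⟩
    exact ⟨u, hu, Quotient.sound (MulAction.orbitRel G V |>.symm ⟨g, rfl⟩)⟩

/-- A finitely generated group acting on a connected graph preserves a minimal nonempty connected
vertex set. -/
theorem Connected.exists_minimal_invariant
    (hadj : ∀ (g : G) a b, X.Adj a b → X.Adj (g • a) (g • b)) (hX : X.Connected)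
    (hfg : Group.FG G) :
    ∃ S : Set V, (∀ (g : G), ∀ w ∈ S, g • w ∈ S) ∧ (X.induce S).Connected ∧
      ∀ S' ⊆ S, (∀ (g : G), ∀ w ∈ S', g • w ∈ S') → (X.induce S').Connected → S' = S := by
  let π : V → Quotient (MulAction.orbitRel G V) := Quotient.mk _
  let C : Set (Set V) := {S | (∀ (g : G), ∀ w ∈ S, g • w ∈ S) ∧ (X.induce S).Connected ∧
    (π '' S).Finite}
  have hC : C.Nonempty := hX.exists_invariant_finite_orbits hadj hfg
  let μ : Set V → ℕ := fun S => (π '' S).ncard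
  refine ⟨Function.argminOn μ C hC, (Function.argminOn_mem μ C hC).1,
    (Function.argminOn_mem μ C hC).2.1, fun S' hsub hinv hconn => ?_⟩
  obtain ⟨-, -, hfin⟩ := Function.argminOn_mem μ C hC
  have himg := Set.image_mono (f := π) hsub
  have hle := Function.argminOn_le μ C (show S' ∈ C from ⟨hinv, hconn, hfin.subset himg⟩)
  have heq := Set.eq_of_subset_of_ncard_le himg hle hfin
  refine hsub.antisymm fun w hw => ?_
  obtain ⟨s, hs, hsw⟩ : π w ∈ π '' S' := heq ▸ Set.mem_image_of_mem π hw
  obtain ⟨g, hg⟩ : (MulAction.orbitRel G V) w s := Quotient.exact hsw.symm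
  exact hg ▸ hinv g s hs

end Action

end SimpleGraph

theorem MulAction.exists_equivariant_map {G X Y : Type*} [Group G] [MulAction G X]
    [MulAction G Y] [Nonempty Y] (P : Set X) (hP : ∀ (g : G), ∀ x ∈ P, g • x ∈ P)
    (h : ∀ x ∈ P, ∃ y : Y, ∀ g : G, g • x = x → g • y = y) :
    ∃ f : X → Y, ∀ (g : G), ∀ x ∈ P, f (g • x) = g • f x := by
  have hrep : ∀ x : X, ∃ g : G, g • (Quotient.mk (MulAction.orbitRel G X) x).out = x := by
    intro x
    obtain ⟨g, hg⟩ : (MulAction.orbitRel G X) (Quotient.mk (MulAction.orbitRel G X) x).out x :=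
      Quotient.exact (Quotient.out_eq _)
    exact ⟨g⁻¹, by rw [← hg]; simp⟩
  choose k hk using hrep
  have h' : ∀ x : X, ∃ y : Y, x ∈ P → ∀ g : G, g • x = x → g • y = y := by
    intro x
    by_cases hx : x ∈ P
    · obtain ⟨y, hy⟩ := h x hx
      exact ⟨y, fun _ => hy⟩
    · exact ⟨Classical.arbitrary Y, fun hx' => absurd hx' hx⟩
  choose c hc using h'
  refine ⟨fun x => k x • c (Quotient.mk (MulAction.orbitRel G X) x).out, fun g x hx => ?_⟩
  have hq : Quotient.mk (MulAction.orbitRel G X) (g • x) = Quotient.mk _ x :=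
    Quotient.sound ⟨g, rfl⟩
  have hgx := hk (g • x)
  have hx' := hk x
  dsimp only
  rw [hq] at hgx ⊢
  set r := (Quotient.mk (MulAction.orbitRel G X) x).out
  have hr : r ∈ P := by
    rw [← inv_smul_eq_iff.2 hx'.symm]
    exact hP _ x hx
  have hfix := hc r hr ((g * k x)⁻¹ * k (g • x)) (by
    rw [mul_smul, hgx, inv_smul_eq_iff, mul_smul, hx'])
  rwa [mul_smul, inv_smul_eq_iff, mul_smul] at hfix

namespace GTree

variable {G : Type u} [Group G]

instance (T : GTree G) : MulAction G T.V where
  smul := T.act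
  one_smul := T.act_one
  mul_smul := T.act_mul

theorem isTree (T : GTree G) : T.graph.IsTree :=
  ⟨T.connected, T.acyclic⟩

theorem exists_attaching_map (T₁ T₂ : GTree G)
    (h : ∀ a b, T₁.graph.Adj a b → T₂.EllipticSubgroup (T₁.edgeStab a b)) :
    ∃ p : Sym2 T₁.V → T₂.V, ∀ g a b, T₁.graph.Adj a b →
      p s(T₁.act g a, T₁.act g b) = T₂.act g (p s(a, b)) := by
  let : MulAction G (Sym2 T₁.V) :=
    { smul := fun g => Sym2.map (T₁.act g)
      one_smul := fun e => by
        induction e with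
        | _ a b => exact congrArg₂ (fun a b => s(a, b)) (T₁.act_one a) (T₁.act_one b)
      mul_smul := fun g k e => by
        induction e with
        | _ a b =>
          exact congrArg₂ (fun a b => s(a, b)) (T₁.act_mul g k a) (T₁.act_mul g k b) }
  have := T₂.nonempty
  have hinv : ∀ (g : G), ∀ e ∈ T₁.graph.edgeSet, g • e ∈ T₁.graph.edgeSet := by
    intro g e
    induction e with
    | _ a b => exact T₁.act_adj g a b
  obtain ⟨p, hp⟩ := MulAction.exists_equivariant_map (Y := T₂.V) T₁.graph.edgeSet hinv (by
    intro e
    induction e with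
    | _ a b =>
      intro hab
      obtain ⟨y, hy⟩ := h a b hab
      refine ⟨y, fun g hg => hy g ?_⟩
      have hg' : s(T₁.act g a, T₁.act g b) = s(a, b) := hg
      rcases Sym2.eq_iff.1 hg' with h' | h'
      · exact h'
      · exact absurd h' (T₁.noInversion g a b hab))
  exact ⟨p, fun g a b hab => hp g s(a, b) hab⟩

end GTree

/-- a universally elliptic common refinement of two universally elliptic
`𝒜`-trees. -/
theorem univ_elliptic_refinement {G : Type u} [Group G] (hfg : Group.FG G)
    (𝒜 : Set (Subgroup G)) (h𝒜 : ClosedFamily 𝒜)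
    (T₁ T₂ : GTree G) (h₁ : T₁.IsATree 𝒜) (h₂ : T₂.IsATree 𝒜)
    (hu₁ : T₁.UnivEllipticTree 𝒜) (hu₂ : T₂.UnivEllipticTree 𝒜) :
    ∃ (T : GTree G) (f : T.V → T₁.V), T.IsATree 𝒜 ∧ T.UnivEllipticTree 𝒜 ∧
      GTree.IsCollapseMap T T₁ f ∧ T.Dominates T₂ ∧
      ∀ H : Subgroup G, T.EllipticSubgroup H ↔
        T₁.EllipticSubgroup H ∧ T₂.EllipticSubgroup H := by
  obtain ⟨p, hp⟩ := T₁.exists_attaching_map T₂ fun a b hab => hu₁ a b hab T₂ h₂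
  let B := T₁.graph.blowup T₂.graph p
  have hB : B.IsTree := SimpleGraph.blowup_isTree T₁.isTree T₂.isTree
  have hadj : ∀ (g : G) a b, B.Adj a b → B.Adj (g • a) (g • b) := by
    rintro g ⟨v, y⟩ ⟨w, z⟩ (⟨h, h'⟩ | ⟨h, h', h''⟩)
    · exact Or.inl ⟨congrArg (T₁.act g) h, T₂.act_adj g _ _ h'⟩
    · exact Or.inr ⟨T₁.act_adj g _ _ h, (congrArg (T₂.act g) h').trans (hp g _ _ h).symm,
        (congrArg (T₂.act g) h'').trans (hp g _ _ h).symm⟩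
  obtain ⟨S, hinv, hconn, hmin⟩ := hB.connected.exists_minimal_invariant hadj hfg
  let T : GTree G :=
    { V := S
      graph := B.induce S
      nonempty := hconn.nonempty
      connected := hconn
      acyclic := hB.isAcyclic.induce S
      act := fun g a => ⟨g • a.1, hinv g _ a.2⟩
      act_one := fun a => Subtype.ext (one_smul G a.1)
      act_mul := fun g k a => Subtype.ext (mul_smul g k a.1)
      act_adj := fun g a b h => hadj g _ _ h
      noInversion := by
        rintro g ⟨⟨v, y⟩, ha⟩ ⟨⟨w, z⟩, hb⟩ hab ⟨h, h'⟩
        have h := Subtype.ext_iff.1 h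
        have h' := Subtype.ext_iff.1 h'
        rcases hab with ⟨-, hyz⟩ | ⟨hvw, -⟩
        · exact T₂.noInversion g y z hyz ⟨congrArg Prod.snd h, congrArg Prod.snd h'⟩
        · exact T₁.noInversion g v w hvw ⟨congrArg Prod.fst h, congrArg Prod.fst h'⟩
      minimal := by
        intro U _ hUinv hU
        rw [SimpleGraph.induce_induce_connected_iff] at hU
        have hUS := hmin (Subtype.val '' U) (Subtype.coe_image_subset S U) (by
          rintro g _ ⟨a, ha, rfl⟩
          exact ⟨_, hUinv g a ha, rfl⟩) hU
        refine Set.eq_univ_of_forall fun a => ?_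
        obtain ⟨b, hb, hab⟩ : a.1 ∈ Subtype.val '' U := hUS.symm ▸ a.2
        exact Subtype.ext hab ▸ hb }
  have hfix₁ : ∀ (g : G) (a : T.V), T.act g a = a → T₁.act g a.1.1 = a.1.1 :=
    fun g a h => congrArg Prod.fst (Subtype.ext_iff.1 h)
  have hfix₂ : ∀ (g : G) (a : T.V), T.act g a = a → T₂.act g a.1.2 = a.1.2 :=
    fun g a h => congrArg Prod.snd (Subtype.ext_iff.1 h)
  have hedge : ∀ a b, T.graph.Adj a b →
      (∃ v w, T₁.graph.Adj v w ∧ T.edgeStab a b ≤ T₁.edgeStab v w) ∨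
        ∃ y z, T₂.graph.Adj y z ∧ T.edgeStab a b ≤ T₂.edgeStab y z := by
    rintro a b (⟨-, h⟩ | ⟨h, -⟩)
    · exact Or.inr ⟨_, _, h, fun g hg => ⟨hfix₂ g a hg.1, hfix₂ g b hg.2⟩⟩
    · exact Or.inl ⟨_, _, h, fun g hg => ⟨hfix₁ g a hg.1, hfix₁ g b hg.2⟩⟩
  have hell : ∀ H : Subgroup G, T.EllipticSubgroup H ↔
      T₁.EllipticSubgroup H ∧ T₂.EllipticSubgroup H := by
    intro H
    constructor
    · rintro ⟨a, ha⟩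
      exact ⟨⟨_, fun h hh => hfix₁ h a (ha h hh)⟩, ⟨_, fun h hh => hfix₂ h a (ha h hh)⟩⟩
    · rintro ⟨⟨v, hv⟩, ⟨y, hy⟩⟩
      obtain ⟨s, hs, hfix⟩ := hB.exists_fixed_of_invariant hadj hinv hconn (H := H) (x := (v, y))
        fun h hh => Prod.ext (hv h hh) (hy h hh)
      exact ⟨⟨s, hs⟩, fun h hh => Subtype.ext (hfix h hh)⟩
  have hsurj : Function.Surjective fun a : T.V => a.1.1 := by
    rw [← Set.range_eq_univ]
    refine T₁.minimal _ (@Set.range_nonempty _ _ T.nonempty _) ?_ ?_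
    · rintro g _ ⟨a, rfl⟩
      exact ⟨T.act g a, rfl⟩
    · refine T.connected.of_surjective_of_adj_reachable (Set.rangeFactorization _)
        Set.rangeFactorization_surjective ?_
      rintro a b (⟨h, -⟩ | ⟨h, -⟩)
      · have : Set.rangeFactorization (fun a : T.V => a.1.1) a = Set.rangeFactorization _ b :=
          Subtype.ext h
        rw [this]
      · exact SimpleGraph.Adj.reachable h
  refine ⟨T, fun a => a.1.1, fun a b hab => ?_, fun a b hab T' hT' => ?_,
    ⟨fun _ _ => rfl, hsurj, ?_, fun v => ?_⟩, fun H hH => ((hell H).1 hH).2, hell⟩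
  · obtain ⟨v, w, hvw, hle⟩ | ⟨y, z, hyz, hle⟩ := hedge a b hab
    · exact h𝒜.2 _ (h₁ v w hvw) _ hle
    · exact h𝒜.2 _ (h₂ y z hyz) _ hle
  · obtain ⟨v, w, hvw, hle⟩ | ⟨y, z, hyz, hle⟩ := hedge a b hab
    · obtain ⟨x, hx⟩ := hu₁ v w hvw T' hT'
      exact ⟨x, fun h hh => hx h (hle hh)⟩
    · obtain ⟨x, hx⟩ := hu₂ y z hyz T' hT'
      exact ⟨x, fun h hh => hx h (hle hh)⟩
  · rintro a b (⟨h, -⟩ | ⟨h, -⟩)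
    · exact Or.inl h
    · exact Or.inr h
  · have hfib : Subtype.val '' ((fun a : T.V => a.1.1) ⁻¹' {v}) = S ∩ {a | a.1 = v} :=
      Subtype.image_preimage_coe S {a | a.1 = v}
    obtain ⟨a, ha⟩ := hsurj v
    refine (SimpleGraph.induce_induce_connected_iff B S _).2 ?_
    rw [hfib]
    exact hB.induce_inter_connected hconn
      (SimpleGraph.blowup_induce_fiber_connected T₂.connected v) ⟨a.1, a.2, ha⟩
end

section
/- Let T₁ and T₂ be universally elliptic 𝒜-trees such that an element of G is elliptic in T₁ if and only if it is elliptic in T₂. Then T₁ and T₂ are in the same deformation space: a subgroup of G is elliptic in T₁ if and only if it is elliptic in T₂. -/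
universe u v

namespace SimpleGraph

variable {V : Type*} {Γ : SimpleGraph V}

/-- In an acyclic graph, two neighbours of `x` joined by a walk avoiding `x` coincide. -/
theorem IsAcyclic.eq_of_walk_avoiding (hΓ : Γ.IsAcyclic) {x a b : V} (ha : Γ.Adj x a)
    (hb : Γ.Adj x b) (p : Γ.Walk a b) (hp : x ∉ p.support) : a = b := by
  classical
  by_contra hab
  have hq : (Walk.cons ha.symm (Walk.cons hb Walk.nil)).IsPath := by
    simp [Walk.cons_isPath_iff, ha.ne', hb.ne, hab]
  have h : p.bypass = _ := congrArg Subtype.val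
    ((hΓ.subsingleton_path a b).elim ⟨_, p.bypass_isPath⟩ ⟨_, hq⟩)
  have hx : x ∈ p.bypass.support := by
    rw [h]
    simp
  exact hp (p.support_bypass_subset_support hx)

/-- A vertex of a geodesic splits its length. -/
theorem dist_add_dist_le_of_mem_support {a b c : V} (p : Γ.Walk a b) (hc : c ∈ p.support) :
    Γ.dist a c + Γ.dist c b ≤ p.length := by
  classical
  have h := congrArg Walk.length (p.take_spec hc)
  rw [Walk.length_append] at h
  have h₁ := dist_le (p.takeUntil c hc)
  have h₂ := dist_le (p.dropUntil c hc)
  omega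

/-- In a connected graph, distinct vertices `x`, `y` are separated by a neighbour of `x`
closer to `y`. -/
theorem Connected.exists_adj_dist_add_one (hΓ : Γ.Connected) {x y : V} (hxy : x ≠ y) :
    ∃ q, Γ.Adj x q ∧ Γ.dist x y = Γ.dist q y + 1 := by
  obtain ⟨p, hp⟩ := hΓ.exists_walk_length_eq_dist x y
  cases p with
  | nil => exact absurd rfl hxy
  | @cons _ q _ h p =>
    refine ⟨q, h, ?_⟩
    have h₁ := dist_le p
    have h₂ := hΓ.dist_triangle (u := x) (v := q) (w := y)
    rw [dist_eq_one_iff_adj.mpr h] at h₂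
    rw [Walk.length_cons] at hp
    omega

/-- In a tree, two geodesics leaving `x` through distinct neighbours concatenate to a geodesic. -/
theorem dist_eq_add_of_adj_ne (hc : Γ.Connected) (hΓ : Γ.IsAcyclic) {x y z q u : V}
    (hq : Γ.Adj x q) (hu : Γ.Adj x u) (hqu : u ≠ q) (hqy : Γ.dist x y = Γ.dist q y + 1)
    (huz : Γ.dist x z = Γ.dist u z + 1) : Γ.dist z y = Γ.dist x z + Γ.dist x y := by
  obtain ⟨p, hp⟩ := hc.exists_walk_length_eq_dist z y
  obtain ⟨r, hr⟩ := hc.exists_walk_length_eq_dist u z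
  obtain ⟨s, hs⟩ := hc.exists_walk_length_eq_dist q y
  have hxr : x ∉ r.support := fun h ↦ by
    have := dist_add_dist_le_of_mem_support r h
    omega
  have hxs : x ∉ s.support := fun h ↦ by
    have := dist_add_dist_le_of_mem_support s h
    omega
  have hxp : x ∈ p.support := by
    by_contra hxp
    refine hqu (hΓ.eq_of_walk_avoiding hu hq ((r.append p).append s.reverse) ?_)
    simp [Walk.mem_support_append_iff, hxr, hxs, hxp]
  have h₁ := dist_add_dist_le_of_mem_support p hxp
  have h₂ := hc.dist_triangle (u := z) (v := x) (w := y)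
  rw [dist_comm (u := z) (v := x)] at h₁ h₂
  omega

end SimpleGraph

namespace GTree

variable {G : Type u} [Group G]

theorem mem_vertexStab {T : GTree G} {w : T.V} {g : G} :
    g ∈ T.vertexStab w ↔ T.act g w = w := Iff.rfl

theorem act_inv_act (T : GTree G) (g : G) (w : T.V) : T.act g⁻¹ (T.act g w) = w := by
  rw [← T.act_mul, inv_mul_cancel, T.act_one]

theorem act_act_inv (T : GTree G) (g : G) (w : T.V) : T.act g (T.act g⁻¹ w) = w := by
  rw [← T.act_mul, mul_inv_cancel, T.act_one]

theorem dist_act_le (T : GTree G) (g : G) (a b : T.V) :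
    T.graph.dist (T.act g a) (T.act g b) ≤ T.graph.dist a b := by
  obtain ⟨p, hp⟩ := T.connected.exists_walk_length_eq_dist a b
  let φ : T.graph →g T.graph := ⟨T.act g, fun h ↦ T.act_adj g _ _ h⟩
  rw [← hp, ← SimpleGraph.Walk.length_map φ p]
  exact SimpleGraph.dist_le (p.map φ)

theorem dist_act (T : GTree G) (g : G) (a b : T.V) :
    T.graph.dist (T.act g a) (T.act g b) = T.graph.dist a b := by
  refine (T.dist_act_le g a b).antisymm ?_
  simpa only [act_inv_act] using T.dist_act_le g⁻¹ (T.act g a) (T.act g b)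

theorem dist_act_of_fixed (T : GTree G) {g : G} {x : T.V} (hx : T.act g x = x) (z : T.V) :
    T.graph.dist x (T.act g z) = T.graph.dist x z := by
  conv_lhs => rw [← hx]
  exact T.dist_act g x z

/-- If `g` fixes `x` but not the first edge of the geodesic from `x` to `y`, then `x` lies on the
geodesic from `y` to `z` or on the one from `y` to `g z`. -/
theorem dist_eq_add_or_of_act_ne (T : GTree G) {g : G} {x y q : T.V} (hx : T.act g x = x)
    (hq : T.graph.Adj x q) (hqy : T.graph.dist x y = T.graph.dist q y + 1)
    (hgq : T.act g q ≠ q) (z : T.V) :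
    T.graph.dist z y = T.graph.dist x z + T.graph.dist x y ∨
      T.graph.dist (T.act g z) y = T.graph.dist x z + T.graph.dist x y := by
  by_cases hxz : x = z
  · subst hxz
    simp
  obtain ⟨u, hu, huz⟩ := T.connected.exists_adj_dist_add_one hxz
  by_cases huq : u = q
  · right
    subst huq
    rw [← T.dist_act_of_fixed hx z]
    refine SimpleGraph.dist_eq_add_of_adj_ne T.connected T.acyclic hq (u := T.act g u) ?_ hgq hqy ?_
    · simpa only [hx] using T.act_adj g x u hu
    · rw [T.dist_act, T.dist_act_of_fixed hx, huz]
  · exact .inl (SimpleGraph.dist_eq_add_of_adj_ne T.connected T.acyclic hq hu huq hqy huz)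

/-- Serre's lemma: two elliptic subgroups generating a subgroup all of whose elements are elliptic
generate an elliptic subgroup. -/
theorem EllipticSubgroup.sup {T : GTree G} {A B : Subgroup G} (hA : T.EllipticSubgroup A)
    (hB : T.EllipticSubgroup B) (h : ∀ g ∈ A ⊔ B, T.EllipticElt g) :
    T.EllipticSubgroup (A ⊔ B) := by
  classical
  have hex : ∃ n, ∃ x y : T.V, A ≤ T.vertexStab x ∧ B ≤ T.vertexStab y ∧
      T.graph.dist x y = n := by
    obtain ⟨x, hx⟩ := hA
    obtain ⟨y, hy⟩ := hB
    exact ⟨_, x, y, hx, hy, rfl⟩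
  obtain ⟨x, y, hx, hy, hn⟩ := Nat.find_spec hex
  have hmin : ∀ x' y' : T.V, A ≤ T.vertexStab x' → B ≤ T.vertexStab y' →
      T.graph.dist x y ≤ T.graph.dist x' y' := fun x' y' hx' hy' ↦
    hn.trans_le (Nat.find_min' hex ⟨x', y', hx', hy', rfl⟩)
  by_cases hxy : x = y
  · subst hxy
    exact ⟨x, sup_le hx hy⟩
  exfalso
  obtain ⟨q, hq, hqy⟩ := T.connected.exists_adj_dist_add_one hxy
  obtain ⟨r, hr, hrx⟩ := T.connected.exists_adj_dist_add_one (Ne.symm hxy)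
  have hAq : ¬ A ≤ T.vertexStab q := fun hle ↦ by
    have := hmin q y hle hy
    omega
  have hBr : ¬ B ≤ T.vertexStab r := fun hle ↦ by
    have := hmin x r hx hle
    rw [SimpleGraph.dist_comm, SimpleGraph.dist_comm (u := x)] at this
    omega
  obtain ⟨a, ha, haq⟩ := SetLike.not_le_iff_exists.mp hAq
  obtain ⟨b, hb, hbr⟩ := SetLike.not_le_iff_exists.mp hBr
  obtain ⟨z, hz⟩ := h (a * b) (mul_mem (Subgroup.mem_sup_left ha) (Subgroup.mem_sup_right hb))
  rw [T.act_mul] at hz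
  have h₁ := T.dist_eq_add_or_of_act_ne (hx ha) hq hqy haq (T.act b z)
  have h₂ := T.dist_eq_add_or_of_act_ne (hy hb) hr hrx hbr z
  have h₃ := T.dist_act_of_fixed (hx ha) (T.act b z)
  have h₄ := T.dist_act_of_fixed (hy hb) z
  rw [hz] at h₁ h₃
  have hpos := T.connected.pos_dist_of_ne hxy
  simp only [SimpleGraph.dist_comm (u := z), SimpleGraph.dist_comm (u := T.act b z),
    SimpleGraph.dist_comm (u := y) (v := x)] at h₁ h₂ h₃ h₄
  omega

/-- A subgroup generated by finitely many elliptic subgroups is elliptic as soon as all its elements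
are. -/
theorem ellipticSubgroup_sSup {T : GTree G} {𝓔 : Set (Subgroup G)} (hfin : 𝓔.Finite)
    (hE : ∀ E ∈ 𝓔, T.EllipticSubgroup E) (h : ∀ g ∈ sSup 𝓔, T.EllipticElt g) :
    T.EllipticSubgroup (sSup 𝓔) := by
  induction 𝓔, hfin using Set.Finite.induction_on with
  | empty =>
    obtain ⟨w⟩ := T.nonempty
    refine ⟨w, fun g hg ↦ ?_⟩
    rw [sSup_empty, Subgroup.mem_bot] at hg
    rw [hg, T.act_one]
  | @insert E 𝓔 _ _ ih =>
    rw [sSup_insert] at h ⊢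
    exact (hE E (Set.mem_insert _ _)).sup
      (ih (fun E' hE' ↦ hE E' (Set.mem_insert_of_mem _ hE'))
        fun g hg ↦ h g (Subgroup.mem_sup_right hg)) h

theorem EllipticElt.ellipticSubgroup_zpowers {T : GTree G} {g : G} (hg : T.EllipticElt g) :
    T.EllipticSubgroup (Subgroup.zpowers g) := by
  obtain ⟨w, hw⟩ := hg
  have hle : Subgroup.zpowers g ≤ T.vertexStab w := Subgroup.zpowers_le.mpr hw
  exact ⟨w, hle⟩

/-- Let `Z` be a set of vertices containing walks from `v` to its translates by a generating set
`S`, and let `K ⊇ S ∪ {1}` be such that every translate of `v` in `Z` is of the form `k v` with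
`k ∈ K`. A subgroup `H` of the stabilizer of `v` is the whole stabilizer provided it contains the
elements of `K⁻¹ K` fixing `v`, and all elements fixing `v` and sending a neighbour of `v` lying in
`K⁻¹ Z` to a vertex in `K⁻¹ Z`. -/
theorem vertexStab_le_of_turns (T : GTree G) (v : T.V) {S K : Set G} {Z : Set T.V}
    {H : Subgroup G} (hS : Submonoid.closure S = ⊤) (hHv : H ≤ T.vertexStab v)
    (hwalk : ∀ s ∈ S, ∃ p : T.graph.Walk v (T.act s v), ∀ w ∈ p.support, w ∈ Z)
    (hK1 : 1 ∈ K) (hSK : S ⊆ K)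
    (hKZ : ∀ g, T.act g v ∈ Z → ∃ k ∈ K, T.act k v = T.act g v)
    (hKH : ∀ k ∈ K, ∀ k' ∈ K, k⁻¹ * k' ∈ T.vertexStab v → k⁻¹ * k' ∈ H)
    (hturn : ∀ k ∈ K, ∀ k' ∈ K, ∀ q ∈ Z, ∀ q' ∈ Z, ∀ g ∈ T.vertexStab v,
      T.graph.Adj v (T.act k⁻¹ q) → T.act g (T.act k⁻¹ q) = T.act k'⁻¹ q' → g ∈ H) :
    T.vertexStab v ≤ H := by
  let A : Set T.V := {m | T.graph.Adj v m ∧ ∃ h ∈ H, ∃ k ∈ K, ∃ q ∈ Z,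
    m = T.act h (T.act k⁻¹ q)}
  let Q : G → T.V → Prop := fun g p ↦
    (T.act g p ≠ v → ∃ m ∈ A, ∃ r : T.graph.Walk m (T.act g p), v ∉ r.support) ∧
      (T.act g p = v → ∀ k ∈ K, T.act k v = p → g * k ∈ H)
  have step : ∀ g p q, p ∈ Z → q ∈ Z → T.graph.Adj p q → Q g p → Q g q := by
    rintro g p q hpZ hqZ hpq ⟨hne, heq⟩
    have hadj := T.act_adj g p q hpq
    refine ⟨fun hqv ↦ ?_, fun hqv k hk hkq ↦ ?_⟩
    · by_cases hpv : T.act g p = v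
      · have hp : T.act g⁻¹ v = p := by rw [← hpv, T.act_inv_act]
        obtain ⟨k, hk, hkp⟩ := hKZ g⁻¹ (hp ▸ hpZ)
        rw [hp] at hkp
        refine ⟨T.act g q, ⟨hpv ▸ hadj, g * k, heq hpv k hk hkp, k, hk, q, hqZ, ?_⟩, .nil, ?_⟩
        · rw [T.act_mul, T.act_act_inv]
        · simpa using Ne.symm hqv
      · obtain ⟨m, hm, r, hr⟩ := hne hpv
        refine ⟨m, hm, r.concat hadj, ?_⟩
        rw [SimpleGraph.Walk.support_concat]
        simp [hr, Ne.symm hqv]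
    · have hpv : T.act g p ≠ v := hqv ▸ hadj.ne
      obtain ⟨m, ⟨hvm, h, hh, k', hk', q', hq', hmq⟩, r, hr⟩ := hne hpv
      have hvp : T.graph.Adj v (T.act g p) := hqv ▸ hadj.symm
      have hmp := T.acyclic.eq_of_walk_avoiding hvm hvp r hr
      have hgk : g * k ∈ T.vertexStab v := by rw [mem_vertexStab, T.act_mul, hkq, hqv]
      have hmem : h⁻¹ * (g * k) ∈ H := by
        refine hturn k hk k' hk' p hpZ q' hq' _
          (mul_mem (inv_mem (hHv hh)) hgk) ?_ ?_
        · have := T.act_adj k⁻¹ _ _ hpq.symm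
          rwa [← hkq, T.act_inv_act] at this
        · rw [T.act_mul, T.act_mul g, T.act_act_inv, ← hmp, hmq, T.act_inv_act]
      simpa using mul_mem hh hmem
  have walk : ∀ g, ∀ {p q : T.V} (r : T.graph.Walk p q), (∀ w ∈ r.support, w ∈ Z) →
      Q g p → Q g q := by
    intro g p q r
    induction r with
    | nil => exact fun _ h ↦ h
    | cons hadj r ih =>
      intro hr hp
      have hr' : ∀ w ∈ r.support, w ∈ Z := fun w hw ↦ hr w (by simp [hw])
      exact ih hr' (step g _ _ (hr _ (by simp)) (hr' _ r.start_mem_support) hadj hp)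
  have hKv : ∀ k ∈ K, T.act k v = v → k ∈ H := fun k hk hkv ↦ by
    simpa using hKH 1 hK1 k hk (by simpa [mem_vertexStab] using hkv)
  have key : ∀ g, Q g v := by
    intro g
    have hg : g ∈ Submonoid.closure S := hS ▸ Submonoid.mem_top g
    induction hg using Submonoid.closure_induction_right with
    | one =>
      refine ⟨fun h ↦ absurd (T.act_one v) h, fun _ k hk hkv ↦ ?_⟩
      simpa using hKv k hk hkv
    | mul_right g hg s hs ih =>
      obtain ⟨p, hp⟩ := hwalk s hs
      obtain ⟨h₁, h₂⟩ := walk g p hp ih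
      rw [← T.act_mul] at h₁ h₂
      exact ⟨h₁, fun h k hk hkv ↦ mul_mem (h₂ h s (hSK hs) rfl) (hKv k hk hkv)⟩
  intro g hg
  simpa using (key g).2 hg 1 hK1 (T.act_one v)

/-- Vertex stabilizers of an action of a finitely generated group on a tree are generated by
finitely many elements and finitely many stabilizers of incident edges. -/
theorem exists_finite_sSup_eq_vertexStab (hfg : Group.FG G) (T : GTree G) (v : T.V) :
    ∃ 𝓔 : Set (Subgroup G), 𝓔.Finite ∧ sSup 𝓔 = T.vertexStab v ∧
      ∀ E ∈ 𝓔, (∃ g ∈ T.vertexStab v, E = Subgroup.zpowers g) ∨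
        ∃ m, T.graph.Adj v m ∧ E = T.edgeStab v m := by
  classical
  obtain ⟨S, hS⟩ := (Group.fg_iff_monoid_fg.mp hfg).fg_top
  choose p _ using fun w ↦ T.connected.exists_walk_length_eq_dist v w
  let Z : Set T.V := ⋃ s ∈ S, {w | w ∈ (p (T.act s v)).support}
  have hZ : Z.Finite := S.finite_toSet.biUnion fun s _ ↦ List.finite_toSet _
  have hκ : ∀ w, ∃ k, (∃ g, T.act g v = w) → T.act k v = w := fun w ↦ by
    by_cases h : ∃ g, T.act g v = w
    · exact ⟨h.choose, fun _ ↦ h.choose_spec⟩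
    · exact ⟨1, fun h' ↦ absurd h' h⟩
  choose κ hκ using hκ
  let K : Set G := insert 1 (S ∪ κ '' Z)
  have hK : K.Finite := (S.finite_toSet.union (hZ.image κ)).insert 1
  let N : Set T.V := {m | T.graph.Adj v m ∧ m ∈ Set.image2 (fun k q ↦ T.act k⁻¹ q) K Z}
  have hN : N.Finite := (hK.image2 _ hZ).subset fun m hm ↦ hm.2
  have hc : ∀ m m', ∃ c, (∃ g ∈ T.vertexStab v, T.act g m = m') →
      c ∈ T.vertexStab v ∧ T.act c m = m' := fun m m' ↦ by
    by_cases h : ∃ g ∈ T.vertexStab v, T.act g m = m'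
    · exact ⟨h.choose, fun _ ↦ h.choose_spec⟩
    · exact ⟨1, fun h' ↦ absurd h' h⟩
  choose c hc using hc
  let F : Set G := (Set.image2 (fun k k' ↦ k⁻¹ * k') K K ∪ Set.image2 c N N) ∩ T.vertexStab v
  have hF : F.Finite := ((hK.image2 _ hK).union (hN.image2 _ hN)).inter_of_left _
  let 𝓔 : Set (Subgroup G) := Subgroup.zpowers '' F ∪ T.edgeStab v '' N
  have hE : ∀ E ∈ 𝓔, (∃ g ∈ T.vertexStab v, E = Subgroup.zpowers g) ∨
      ∃ m, T.graph.Adj v m ∧ E = T.edgeStab v m := by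
    rintro E (⟨g, hg, rfl⟩ | ⟨m, hm, rfl⟩)
    · exact .inl ⟨g, hg.2, rfl⟩
    · exact .inr ⟨m, hm.1, rfl⟩
  have hle : sSup 𝓔 ≤ T.vertexStab v := sSup_le fun E hE' ↦ by
    obtain ⟨g, hg, rfl⟩ | ⟨m, _, rfl⟩ := hE E hE'
    · exact Subgroup.zpowers_le.mpr hg
    · exact inf_le_left
  have hFH : ∀ g ∈ F, g ∈ sSup 𝓔 := fun g hg ↦
    (le_sSup (Or.inl ⟨g, hg, rfl⟩) : Subgroup.zpowers g ≤ sSup 𝓔) (Subgroup.mem_zpowers g)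
  refine ⟨𝓔, (hF.image _).union (hN.image _), hle.antisymm ?_, hE⟩
  refine T.vertexStab_le_of_turns v (S := S) (K := K) (Z := Z) hS hle ?_ ?_ ?_ ?_ ?_ ?_
  · exact fun s hs ↦ ⟨p (T.act s v), fun w hw ↦ Set.mem_biUnion hs hw⟩
  · exact Set.mem_insert _ _
  · exact fun s hs ↦ Or.inr (Or.inl hs)
  · exact fun g hg ↦ ⟨κ (T.act g v), Or.inr (Or.inr ⟨_, hg, rfl⟩), hκ _ ⟨g, rfl⟩⟩
  · exact fun k hk k' hk' h ↦ hFH _ ⟨Or.inl ⟨k, hk, k', hk', rfl⟩, h⟩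
  · intro k hk k' hk' q hq q' hq' g hg hadj hgq
    have hm : T.act k⁻¹ q ∈ N := ⟨hadj, k, hk, q, hq, rfl⟩
    have hadj' := T.act_adj g _ _ hadj
    rw [mem_vertexStab.mp hg, hgq] at hadj'
    have hm' : T.act k'⁻¹ q' ∈ N := ⟨hadj', k', hk', q', hq', rfl⟩
    obtain ⟨hcv, hcm⟩ := hc _ _ ⟨g, hg, hgq⟩
    set d := c (T.act k⁻¹ q) (T.act k'⁻¹ q')
    have hdH : d ∈ sSup 𝓔 := hFH _ ⟨Or.inr ⟨_, hm, _, hm', rfl⟩, hcv⟩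
    have hstab : d⁻¹ * g ∈ T.edgeStab v (T.act k⁻¹ q) := by
      refine Subgroup.mem_inf.mpr ⟨mul_mem (inv_mem hcv) hg, ?_⟩
      change T.act (d⁻¹ * g) _ = _
      rw [T.act_mul, hgq, ← hcm, T.act_inv_act]
    have hmem : d⁻¹ * g ∈ sSup 𝓔 :=
      (le_sSup (Or.inr ⟨_, hm, rfl⟩) : T.edgeStab v (T.act k⁻¹ q) ≤ sSup 𝓔) hstab
    simpa using mul_mem hdH hmem

/-- A `G`-tree `T₁` dominates `T₂` as soon as its edge stabilizers and its elliptic elements are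
elliptic in `T₂`. -/
theorem dominates_of_ellipticElt (hfg : Group.FG G) {T₁ T₂ : GTree G}
    (hedge : ∀ a b, T₁.graph.Adj a b → T₂.EllipticSubgroup (T₁.edgeStab a b))
    (helts : ∀ g, T₁.EllipticElt g → T₂.EllipticElt g) : T₁.Dominates T₂ := by
  rintro H ⟨v, hv⟩
  obtain ⟨𝓔, hfin, hsup, hE⟩ := T₁.exists_finite_sSup_eq_vertexStab hfg v
  obtain ⟨w, hw⟩ : T₂.EllipticSubgroup (sSup 𝓔) := by
    refine ellipticSubgroup_sSup hfin (fun E hE' ↦ ?_) fun g hg ↦ helts g ⟨v, ?_⟩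
    · obtain ⟨g, hg, rfl⟩ | ⟨m, hm, rfl⟩ := hE E hE'
      · exact (helts g ⟨v, hg⟩).ellipticSubgroup_zpowers
      · exact hedge v m hm
    · rwa [hsup] at hg
  exact ⟨w, fun h hh ↦ hw h (hsup ▸ hv h hh)⟩

end GTree

/-- universally elliptic `𝒜`-trees with the same elliptic elements lie in
the same deformation space. -/
theorem same_deformation_space {G : Type u} [Group G] (hfg : Group.FG G)
    (𝒜 : Set (Subgroup G)) (h𝒜 : ClosedFamily 𝒜)
    (T₁ T₂ : GTree G) (h₁ : T₁.IsATree 𝒜) (h₂ : T₂.IsATree 𝒜)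
    (hu₁ : T₁.UnivEllipticTree 𝒜) (hu₂ : T₂.UnivEllipticTree 𝒜)
    (helts : ∀ g : G, T₁.EllipticElt g ↔ T₂.EllipticElt g) :
    ∀ H : Subgroup G, T₁.EllipticSubgroup H ↔ T₂.EllipticSubgroup H := by
  exact fun H ↦
    ⟨GTree.dominates_of_ellipticElt hfg (fun a b h ↦ hu₁ a b h T₂ h₂) (fun g ↦ (helts g).1) H,
      GTree.dominates_of_ellipticElt hfg (fun a b h ↦ hu₂ a b h T₁ h₁) (fun g ↦ (helts g).2) H⟩
end
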